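/- Soundness and completeness of the causal discovery algorithm (Theorem 1, abstract structural form): Let G = (V, E) be a DAG with self-loops, G̃ = (Ṽ, Ẽ) its lifted graph, and consider the lifted recursive σ-algebra system (𝒩_v)_{v∈Ṽ}, (𝒴_v)_{v∈Ṽ}. Assume faithfulness: (F1) for all distinct i, j ∈ V and all K ⊆ V \ {i, j}, if 𝒴_{i₀} ⫫ 𝒴_{j₁} | (𝒴_{j₀} ⋁ (⋁_{k∈K} (𝒴_{k₀} ⋁ 𝒴_{k₁}))) then i₀ and j₁ are d-separated in G̃ given {j₀} ∪ {k₀, k₁ : k ∈ K}; and (F2) for all i ∈ V, if 𝒴_{i₀} ⫫ 𝒴_{i₁} | (⋁_{k∈pa(i)\{i}} (𝒴_{k₀} ⋁ 𝒴_{k₁})) then i₀ and i₁ are d-separated in G̃ given {k₀, k₁ : k ∈ pa(i) \ {i}}. Then: (a) for all distinct i, j ∈ V, (i → j) ∈ E if and only if there is no K ⊆ V \ {i, j} such that 𝒴_{i₀} ⫫ 𝒴_{j₁} | (𝒴_{j₀} ⋁ (⋁_{k∈K} (𝒴_{k₀} ⋁ 𝒴_{k₁}))); and (b) for all i ∈ V,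 (i → i) ∈ E if and only if 𝒴_{i₀} ⫫ 𝒴_{i₁} | (⋁_{k∈pa(i)\{i}} (𝒴_{k₀} ⋁ 𝒴_{k₁})) fails. In particular, the conditional independence relation uniquely determines the true dependence graph G. -/

import Mathlib

open ProbabilityTheory

open Sum

/-- `G = (V, E)` is a DAG with self-loops: every directed cycle stays at a single
vertex, i.e., is a self-loop. -/
def IsDAGWithLoops {V : Type*} (E : V → V → Prop) : Prop :=
  ∀ (k : ℕ) (w : ℕ → V), 1 ≤ k → w k = w 0 →
    (∀ l < k, E (w l) (w (l + 1))) → ∀ l ≤ k, w l = w 0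

/-- The edge relation of the lifted graph `G̃` on `Ṽ = V₀ ⊔ V₁` (`inl i = i₀`,
`inr i = i₁`): `i₀ → i₁` for every self-loop `i → i`, and `i₀ → j₀`, `i₁ → j₁`,
`i₀ → j₁` for every edge `i → j` with `i ≠ j`. -/
def liftedEdge {V : Type*} (E : V → V → Prop) : V ⊕ V → V ⊕ V → Prop
  | .inl i, .inl j => i ≠ j ∧ E i j
  | .inl i, .inr j => (i = j ∧ E i i) ∨ (i ≠ j ∧ E i j)
  | .inr i, .inr j => i ≠ j ∧ E i j
  | .inr _, .inl _ => False

/-- The parents of `j`: `pa(j) = {i : (i → j) ∈ E}`. -/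
def parents {V : Type*} (E : V → V → Prop) (j : V) : Set V := {i | E i j}


/-- `v 0, …, v m` is a path between `a` and `b` in the directed graph with edge
relation `F`: at least one edge (`m ≥ 1`, i.e. at least two vertices), endpoints
`a` and `b`, pairwise distinct vertices, and consecutive vertices joined by an
edge in one direction or the other. -/
def IsPath {W : Type*} (F : W → W → Prop) (a b : W) (m : ℕ) (v : ℕ → W) : Prop :=
  1 ≤ m ∧ v 0 = a ∧ v m = b ∧
  (∀ l ≤ m, ∀ l' ≤ m, v l = v l' → l = l') ∧
  (∀ l < m, F (v l) (v (l + 1)) ∨ F (v (l + 1)) (v l))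

/-- The interior vertex `v l` is a collider on the path `v`. -/
def IsCollider {W : Type*} (F : W → W → Prop) (v : ℕ → W) (l : ℕ) : Prop :=
  F (v (l - 1)) (v l) ∧ F (v (l + 1)) (v l)

/-- The path `v 0, …, v m` is blocked by the conditioning set `C`: it contains an
interior non-collider vertex belonging to `C`, or an interior collider vertex
none of whose descendants (via `Relation.ReflTransGen F`) belongs to `C`. -/
def Blocked {W : Type*} (F : W → W → Prop) (C : Set W) (m : ℕ) (v : ℕ → W) : Prop :=
  ∃ l, 0 < l ∧ l < m ∧
    ((¬ IsCollider F v l ∧ v l ∈ C) ∨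
      (IsCollider F v l ∧ ∀ u, Relation.ReflTransGen F (v l) u → u ∉ C))

/-- `a` and `b` are d-separated given `C`: every path between them is blocked. -/
def DSep {W : Type*} (F : W → W → Prop) (a b : W) (C : Set W) : Prop :=
  ∀ (m : ℕ) (v : ℕ → W), IsPath F a b m v → Blocked F C m v

/-- The vertex sets `A` and `B` are d-separated given `C`. -/
def DSepSet {W : Type*} (F : W → W → Prop) (A B C : Set W) : Prop :=
  ∀ a ∈ A, ∀ b ∈ B, DSep F a b C


open MeasureTheory in
theorem aux_condExp {Ω : Type*} {mΩ : MeasurableSpace Ω}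
    (μ : Measure Ω) [IsProbabilityMeasure μ] (C B N : MeasurableSpace Ω)
    (hC : C ≤ mΩ) (hB : B ≤ mΩ) (hN : N ≤ mΩ) (hCB : C ≤ B) (h : Indep N B μ)
    (a n : Set Ω) (ha : MeasurableSet[B] a) (hn : MeasurableSet[N] n) :
    (μ⟦a ∩ n | C⟧) =ᵐ[μ] fun ω => μ.real n * (μ⟦a | C⟧) ω := by
  symm
  have ha' := hB _ ha
  have hn' := hN _ hn
  refine ae_eq_condExp_of_forall_setIntegral_eq hC ?_ ?_ ?_ ?_
  · exact (integrable_const (1 : ℝ)).indicator (ha'.inter hn')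
  · intro s _ _
    exact (integrable_condExp.const_mul _).integrableOn
  · intro s hs _
    rw [integral_const_mul, setIntegral_condExp hC ((integrable_const (1 : ℝ)).indicator ha') hs,
      setIntegral_indicator ha', setIntegral_indicator (ha'.inter hn')]
    simp only [setIntegral_const, smul_eq_mul, mul_one]
    have h1 := (Indep_iff _ _ μ).1 h n (s ∩ a) hn (@MeasurableSet.inter _ B _ _ (hCB _ hs) ha)
    have h2 : s ∩ (a ∩ n) = n ∩ (s ∩ a) := by ext; simp; tauto
    rw [h2, measureReal_def, measureReal_def, measureReal_def, h1, ENNReal.toReal_mul]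
  · exact (stronglyMeasurable_condExp.const_mul _).aestronglyMeasurable

open MeasureTheory in
theorem aux_condIndep {Ω : Type*} {mΩ : MeasurableSpace Ω} [StandardBorelSpace Ω]
    (μ : Measure Ω) [IsProbabilityMeasure μ] (C A N : MeasurableSpace Ω)
    (hC : C ≤ mΩ) (hA : A ≤ mΩ) (hN : N ≤ mΩ) (h : Indep N (C ⊔ A) μ) :
    CondIndep C A (N ⊔ C) hC μ := by
  have hCA : C ⊔ A ≤ mΩ := sup_le hC hA
  set p : Set (Set Ω) := {s | ∃ c n, MeasurableSet[C] c ∧ MeasurableSet[N] n ∧ s = c ∩ n} with hp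
  have hpm : ∀ s ∈ p, MeasurableSet[mΩ] s := by
    rintro s ⟨c, n, hc, hn, rfl⟩
    exact (hC _ hc).inter (hN _ hn)
  refine CondIndepSets.condIndep (p1 := {s | MeasurableSet[A] s}) (p2 := p)
    hA (sup_le hN hC) (@MeasurableSpace.isPiSystem_measurableSet _ A) ?_
    (@MeasurableSpace.generateFrom_measurableSet _ A).symm ?_ ?_
  · rintro s ⟨c, n, hc, hn, rfl⟩ t ⟨c', n', hc', hn', rfl⟩ _
    refine ⟨c ∩ c', n ∩ n', @MeasurableSet.inter _ C _ _ hc hc',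
      @MeasurableSet.inter _ N _ _ hn hn', ?_⟩
    ext; simp; tauto
  · apply le_antisymm
    · refine sup_le ?_ ?_
      · intro n hn
        exact MeasurableSpace.measurableSet_generateFrom
          ⟨Set.univ, n, @MeasurableSet.univ _ C, hn, by simp⟩
      · intro c hc
        exact MeasurableSpace.measurableSet_generateFrom
          ⟨c, Set.univ, hc, @MeasurableSet.univ _ N, by simp⟩
    · refine MeasurableSpace.generateFrom_le ?_
      rintro s ⟨c, n, hc, hn, rfl⟩
      exact @MeasurableSet.inter _ (N ⊔ C) _ _ ((le_sup_right : C ≤ N ⊔ C) _ hc)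
        ((le_sup_left : N ≤ N ⊔ C) _ hn)
  · refine (condIndepSets_iff C hC {s | MeasurableSet[A] s} p (fun s hs => hA s hs) hpm μ).2 ?_
    rintro a s ha ⟨c, n, hc, hn, rfl⟩
    have ha1 : MeasurableSet[C ⊔ A] a := (le_sup_right : A ≤ C ⊔ A) _ ha
    have hc1 : MeasurableSet[C ⊔ A] c := (le_sup_left : C ≤ C ⊔ A) _ hc
    have e1 := aux_condExp μ C (C ⊔ A) N hC hCA hN le_sup_left h (c ∩ a) n
      (@MeasurableSet.inter _ (C ⊔ A) _ _ hc1 ha1) hn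
    have e2 := aux_condExp μ C (C ⊔ A) N hC hCA hN le_sup_left h c n hc1 hn
    have e3 : (μ⟦c ∩ a | C⟧) =ᵐ[μ] c.indicator (μ⟦a | C⟧) := by
      have := condExp_indicator (μ := μ) (m := C)
        ((integrable_const (1 : ℝ)).indicator (hA _ ha)) hc
      rwa [Set.indicator_indicator] at this
    have e4 : (μ⟦c | C⟧) = c.indicator (fun _ => (1 : ℝ)) :=
      condExp_of_stronglyMeasurable hC (stronglyMeasurable_const.indicator hc)
        ((integrable_const (1 : ℝ)).indicator (hC _ hc))
    have e5 : a ∩ (c ∩ n) = (c ∩ a) ∩ n := by ext; simp; tauto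
    rw [e5]
    rw [e4] at e2
    filter_upwards [e1, e2, e3] with ω h1 h2 h3
    rw [h1, Pi.mul_apply, h2, h3]
    by_cases hω : ω ∈ c <;> simp [hω]
    ring

theorem aux_seq {V : Type*} {R : V → V → Prop} {a b : V} (h : Relation.TransGen R a b) :
    ∃ (k : ℕ) (w : ℕ → V), 1 ≤ k ∧ w 0 = a ∧ w k = b ∧ ∀ l < k, R (w l) (w (l + 1)) := by
  induction h using Relation.TransGen.head_induction_on with
  | single hab =>
    rename_i a
    refine ⟨1, fun n => if n = 0 then a else b, le_rfl, by simp, by simp, ?_⟩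
    intro l hl
    obtain rfl : l = 0 := by omega
    simpa using hab
  | @head a c hac _ ih =>
    obtain ⟨k, w, hk, h0, hkb, hw⟩ := ih
    refine ⟨k + 1, fun n => if n = 0 then a else w (n - 1), by omega, by simp, by simp [hkb], ?_⟩
    intro l hl
    rcases l with _ | l
    · simpa [h0] using hac
    · simpa using hw l (by omega)

theorem aux_irrefl {V : Type*} {E : V → V → Prop} (hG : IsDAGWithLoops E) (a : V) :
    ¬ Relation.TransGen (fun i j => i ≠ j ∧ E i j) a a := by
  intro h
  obtain ⟨k, w, hk, h0, hkb, hw⟩ := aux_seq h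
  have := hG k w hk (hkb.trans h0.symm) (fun l hl => (hw l hl).2) 1 hk
  exact (hw 0 (by omega)).1 this.symm

theorem aux_wf {V : Type*} [Finite V] {E : V → V → Prop} (hG : IsDAGWithLoops E) :
    WellFounded (fun i j : V => i ≠ j ∧ E i j) := by
  have : Std.Irrefl (Relation.TransGen (fun i j : V => i ≠ j ∧ E i j)) := ⟨aux_irrefl hG⟩
  have h := Finite.wellFounded_of_trans_of_irrefl
    (Relation.TransGen (fun i j : V => i ≠ j ∧ E i j))
  exact Subrelation.wf (r := Relation.TransGen (fun i j : V => i ≠ j ∧ E i j))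
    (fun h => Relation.TransGen.single h) h

theorem aux_nondesc {Ω V : Type*} [Finite V] {E : V → V → Prop} (hG : IsDAGWithLoops E)
    (N Y : V ⊕ V → MeasurableSpace Ω)
    (hRec : ∀ v, Y v ≤ N v ⊔ ⨆ u ∈ {u | liftedEdge E u v}, Y u) (j : V) :
    (∀ i, Y (Sum.inl i) ≤ ⨆ u ∈ {u | u ≠ Sum.inr j}, N u) ∧
    (∀ i, ¬ Relation.ReflTransGen (fun i j => i ≠ j ∧ E i j) j i →
      Y (Sum.inr i) ≤ ⨆ u ∈ {u | u ≠ Sum.inr j}, N u) := by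
  have h0 : ∀ i, Y (Sum.inl i) ≤ ⨆ u ∈ {u | u ≠ Sum.inr j}, N u := by
    intro i
    induction i using (aux_wf hG).induction with
    | _ i ih =>
      refine (hRec _).trans (sup_le ?_ (iSup₂_le ?_))
      · exact le_biSup N (i := Sum.inl i) (by simp)
      · rintro (u | u) hu
        · exact ih u hu
        · exact hu.elim
  refine ⟨h0, ?_⟩
  intro i
  induction i using (aux_wf hG).induction with
  | _ i ih =>
    intro hi
    refine (hRec _).trans (sup_le ?_ (iSup₂_le ?_))
    · refine le_biSup N (i := Sum.inr i) ?_
      intro h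
      cases h
      exact hi .refl
    · rintro (u | u) hu
      · exact h0 u
      · exact ih u hu (fun h => hi (h.tail hu))

theorem aux_main {Ω V : Type*} [Finite V] {mΩ : MeasurableSpace Ω} [StandardBorelSpace Ω]
    (μ : MeasureTheory.Measure Ω) [MeasureTheory.IsProbabilityMeasure μ]
    {E : V → V → Prop} (hG : IsDAGWithLoops E)
    (N Y : V ⊕ V → MeasurableSpace Ω)
    (hN : ∀ v, N v ≤ mΩ) (hY : ∀ v, Y v ≤ mΩ)
    (hIndep : iIndep N μ)
    (hRec : ∀ v, Y v ≤ N v ⊔ ⨆ u ∈ {u | liftedEdge E u v}, Y u)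
    (i j : V) (C : MeasurableSpace Ω) (hC : C ≤ mΩ)
    (h1 : C ≤ Y (Sum.inl j) ⊔
      ⨆ k ∈ parents E j \ {j}, (Y (Sum.inl k) ⊔ Y (Sum.inr k)))
    (h2 : ∀ u, liftedEdge E u (Sum.inr j) → Y u ≤ C) :
    CondIndep C (Y (Sum.inl i)) (Y (Sum.inr j)) hC μ := by
  obtain ⟨hl, hr⟩ := aux_nondesc hG N Y hRec j
  have hind := indep_iSup_of_disjoint hN hIndep
    (S := {Sum.inr j}) (T := {u | u ≠ Sum.inr j}) (by simp)
  have hle : C ⊔ Y (Sum.inl i) ≤ ⨆ u ∈ {u | u ≠ Sum.inr j}, N u := by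
    refine sup_le (h1.trans (sup_le (hl j) (iSup₂_le fun k hk => sup_le (hl k) (hr k ?_)))) (hl i)
    intro h
    exact aux_irrefl hG j (Relation.TransGen.tail' h ⟨hk.2, hk.1⟩)
  have hind' : Indep (N (Sum.inr j)) (C ⊔ Y (Sum.inl i)) μ := by
    refine indep_of_indep_of_le_right (indep_of_indep_of_le_left hind ?_) hle
    simp
  have := aux_condIndep μ C (Y (Sum.inl i)) (N (Sum.inr j)) hC (hY _) (hN _) hind'
  refine condIndep_of_condIndep_of_le_right this ?_
  exact (hRec _).trans (sup_le_sup le_rfl (iSup₂_le h2))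

theorem aux_edge {W : Type*} {F : W → W → Prop} {a b : W} {C : Set W} (hab : a ≠ b)
    (h : F a b) : ¬ DSep F a b C := by
  intro hd
  obtain ⟨l, h0, h1, _⟩ := hd 1 (fun n => if n = 0 then a else b)
    ⟨le_rfl, by simp, by simp, by
      intro l hl l' hl' he
      have e1 : l = 0 ∨ l = 1 := by omega
      have e2 : l' = 0 ∨ l' = 1 := by omega
      rcases e1 with rfl | rfl <;> rcases e2 with rfl | rfl <;> simp_all, by
      intro l hl
      obtain rfl : l = 0 := by omega
      left; simpa using h⟩
  omega


/-- soundness and completeness of the causal discovery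
algorithm; Theorem 1, abstract structural form. In the lifted recursive
σ-algebra system over a DAG with self-loops `G = (V, E)`, assuming faithfulness
(F1) and (F2), the conditional independence relation determines the edges of
`G` exactly: (a) for distinct `i, j`, `(i → j) ∈ E` iff no conditioning set
`K ⊆ V \ {i, j}` renders `Y i₀` and `Y j₁` conditionally independent given
`Y j₀ ⊔ ⨆ k ∈ K, (Y k₀ ⊔ Y k₁)`; and (b) `(i → i) ∈ E` iff `Y i₀` and `Y i₁`
are not conditionally independent given `⨆ k ∈ pa(i) \ {i}, (Y k₀ ⊔ Y k₁)`. -/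
theorem causal_discovery_sound_complete
    {Ω V : Type*} [Fintype V] {mΩ : MeasurableSpace Ω} [StandardBorelSpace Ω]
    (μ : MeasureTheory.Measure Ω) [MeasureTheory.IsProbabilityMeasure μ]
    (E : V → V → Prop) (hG : IsDAGWithLoops E)
    (N Y : V ⊕ V → MeasurableSpace Ω)
    (hN : ∀ v, N v ≤ mΩ) (hY : ∀ v, Y v ≤ mΩ)
    (hIndep : iIndep N μ)
    (hRec : ∀ v, Y v ≤ N v ⊔ ⨆ u ∈ {u | liftedEdge E u v}, Y u)
    (F1 : ∀ (i j : V), i ≠ j → ∀ K : Set V, i ∉ K → j ∉ K →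
      ∀ (hc : (Y (Sum.inl j) ⊔ ⨆ k ∈ K, (Y (Sum.inl k) ⊔ Y (Sum.inr k))) ≤ mΩ),
      CondIndep (Y (Sum.inl j) ⊔ ⨆ k ∈ K, (Y (Sum.inl k) ⊔ Y (Sum.inr k)))
        (Y (Sum.inl i)) (Y (Sum.inr j)) hc μ →
      DSep (liftedEdge E) (Sum.inl i) (Sum.inr j)
        ({Sum.inl j} ∪ Sum.inl '' K ∪ Sum.inr '' K))
    (F2 : ∀ i : V,
      ∀ (hc : (⨆ k ∈ parents E i \ {i}, (Y (Sum.inl k) ⊔ Y (Sum.inr k))) ≤ mΩ),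
      CondIndep (⨆ k ∈ parents E i \ {i}, (Y (Sum.inl k) ⊔ Y (Sum.inr k)))
        (Y (Sum.inl i)) (Y (Sum.inr i)) hc μ →
      DSep (liftedEdge E) (Sum.inl i) (Sum.inr i)
        (Sum.inl '' (parents E i \ {i}) ∪ Sum.inr '' (parents E i \ {i}))) :
    (∀ (i j : V), i ≠ j →
      (E i j ↔ ¬ ∃ (K : Set V) (_ : i ∉ K) (_ : j ∉ K)
        (hc : (Y (Sum.inl j) ⊔ ⨆ k ∈ K, (Y (Sum.inl k) ⊔ Y (Sum.inr k))) ≤ mΩ),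
        CondIndep (Y (Sum.inl j) ⊔ ⨆ k ∈ K, (Y (Sum.inl k) ⊔ Y (Sum.inr k)))
          (Y (Sum.inl i)) (Y (Sum.inr j)) hc μ)) ∧
    (∀ i : V,
      (E i i ↔ ¬ ∃ (hc : (⨆ k ∈ parents E i \ {i}, (Y (Sum.inl k) ⊔ Y (Sum.inr k))) ≤ mΩ),
        CondIndep (⨆ k ∈ parents E i \ {i}, (Y (Sum.inl k) ⊔ Y (Sum.inr k)))
          (Y (Sum.inl i)) (Y (Sum.inr i)) hc μ)) := by
  constructor
  · intro i j hij
    constructor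
    · rintro h ⟨K, hi, hj, hc, hci⟩
      exact aux_edge (by simp) (show liftedEdge E (Sum.inl i) (Sum.inr j) from Or.inr ⟨hij, h⟩)
        (F1 i j hij K hi hj hc hci)
    · intro h
      by_contra hE
      refine h ⟨parents E j \ {j}, fun hi => hE hi.1, fun hj => hj.2 rfl,
        sup_le (hY _) (iSup₂_le fun k _ => sup_le (hY _) (hY _)), ?_⟩
      refine aux_main μ hG N Y hN hY hIndep hRec i j _ _ le_rfl ?_
      rintro (u | u) hu
      · rcases hu with ⟨rfl, _⟩ | ⟨hne, hu⟩
        · exact le_sup_left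
        · exact (le_sup_left.trans (le_biSup (fun k => Y (Sum.inl k) ⊔ Y (Sum.inr k))
            (show u ∈ parents E j \ {j} from ⟨hu, hne⟩))).trans le_sup_right
      · exact (le_sup_right.trans (le_biSup (fun k => Y (Sum.inl k) ⊔ Y (Sum.inr k))
            (show u ∈ parents E j \ {j} from ⟨hu.2, hu.1⟩))).trans le_sup_right
  · intro i
    constructor
    · rintro h ⟨hc, hci⟩
      exact aux_edge (by simp) (show liftedEdge E (Sum.inl i) (Sum.inr i) from Or.inl ⟨rfl, h⟩)
        (F2 i hc hci)
    · intro h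
      by_contra hE
      refine h ⟨iSup₂_le fun k _ => sup_le (hY _) (hY _), ?_⟩
      refine aux_main μ hG N Y hN hY hIndep hRec i i _ _ le_sup_right ?_
      rintro (u | u) hu
      · rcases hu with ⟨rfl, hu⟩ | ⟨hne, hu⟩
        · exact (hE hu).elim
        · exact le_sup_left.trans (le_biSup (fun k => Y (Sum.inl k) ⊔ Y (Sum.inr k))
            (show u ∈ parents E i \ {i} from ⟨hu, hne⟩))
      · exact le_sup_right.trans (le_biSup (fun k => Y (Sum.inl k) ⊔ Y (Sum.inr k))
            (show u ∈ parents E i \ {i} from ⟨hu.2, hu.1⟩))
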